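/- Let a, b ≥ 0 and work in ℂ[x₁,…,x_a,y₁,…,y_b]. If m > a and n > b, then the m×m determinant det( h_{n−i+j}(X−Y) )_{1≤i,j≤m} is the zero polynomial. -/

import Mathlib

open MvPolynomial

/-- `h_k(X−Y) := ∑_{j=0}^{k} (−1)^j e_j(Y)·h_{k−j}(X)` in `ℂ[x₁,…,x_a,y₁,…,y_b]`,
extended by `0` for negative indices `k : ℤ`. -/
noncomputable def hXYZ (a b : ℕ) (k : ℤ) : MvPolynomial (Fin a ⊕ Fin b) ℂ :=
  if 0 ≤ k then
    ∑ j ∈ Finset.range (k.toNat + 1),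
      ((-1 : ℂ) ^ j) •
        (rename Sum.inr (esymm (Fin b) ℂ j) * rename Sum.inl (hsymm (Fin a) ℂ (k.toNat - j)))
  else 0

/-- The generating function `∑ₖ (-1)ᵏ eₖ tᵏ` of the signed elementary symmetric polynomials. -/
noncomputable def esymmSeries (σ R : Type*) [Fintype σ] [CommRing R] :
    PowerSeries (MvPolynomial σ R) :=
  PowerSeries.mk fun k => (-1) ^ k * esymm σ R k

theorem esymmSeries_eq_prod (σ R : Type*) [Fintype σ] [CommRing R] :
    esymmSeries σ R = ∏ i : σ, (1 - PowerSeries.C (X i) * PowerSeries.X) := by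
  classical
  ext1 k
  simp only [esymmSeries, PowerSeries.coeff_mk, sub_eq_add_neg, Finset.prod_one_add,
    Finset.prod_neg, Finset.prod_mul_distrib, Finset.prod_const, ← map_prod, map_sum]
  have h (t : Finset σ) :
      PowerSeries.coeff k ((-1) ^ t.card *
        (PowerSeries.C (∏ i ∈ t, X i : MvPolynomial σ R) * PowerSeries.X ^ t.card)) =
      if t.card = k then (-1) ^ k * ∏ i ∈ t, X i else 0 := by
    rw [show ((-1) ^ t.card : PowerSeries (MvPolynomial σ R)) = PowerSeries.C ((-1) ^ t.card) by
      simp, ← mul_assoc, ← map_mul, PowerSeries.coeff_C_mul, PowerSeries.coeff_X_pow]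
    by_cases hk : t.card = k
    · simp [hk]
    · simp [hk, Ne.symm hk]
  simp only [h, ← Finset.sum_filter, esymm, Finset.mul_sum]
  exact Finset.sum_congr (by ext; simp) fun _ _ => rfl

theorem mk_hsymm_eq_prod (σ R : Type*) [Fintype σ] [DecidableEq σ] [CommRing R] :
    PowerSeries.mk (hsymm σ R) = ∏ i : σ, PowerSeries.mk fun n => (X i : MvPolynomial σ R) ^ n := by
  ext1 k
  rw [PowerSeries.coeff_prod, PowerSeries.coeff_mk, hsymm]
  simp only [PowerSeries.coeff_mk]
  refine Finset.sum_bij' (fun s _ => Multiset.toFinsupp (s : Multiset σ))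
    (fun l hl => ⟨Finsupp.toMultiset l, ?_⟩) ?_ ?_ ?_ ?_ ?_
  · rw [Finsupp.card_toMultiset, Finsupp.sum_fintype _ _ (by simp)]
    simpa using hl
  · intro s _
    rw [Finset.mem_finsuppAntidiag]
    refine ⟨?_, Finset.subset_univ _⟩
    change ∑ i, (s : Multiset σ).count i = k
    rw [Multiset.sum_count_eq_card (by simp)]
    exact s.2
  · intro l _
    exact Finset.mem_univ _
  · intro s _
    exact Subtype.ext (by simp)
  · intro l _
    simp
  · intro s _
    rw [Finset.prod_multiset_map_count]
    refine Finset.prod_subset (Finset.subset_univ _) fun x _ hx => ?_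
    simp_all

theorem mk_hsymm_mul_esymmSeries (σ R : Type*) [Fintype σ] [DecidableEq σ] [CommRing R] :
    PowerSeries.mk (hsymm σ R) * esymmSeries σ R = 1 := by
  rw [mk_hsymm_eq_prod, esymmSeries_eq_prod, ← Finset.prod_mul_distrib]
  refine Finset.prod_eq_one fun i _ => ?_
  ext k
  rw [mul_sub, mul_one, mul_left_comm, map_sub, PowerSeries.coeff_C_mul]
  cases k with
  | zero => simp
  | succ k => simp [PowerSeries.coeff_succ_mul_X, pow_succ', PowerSeries.coeff_one]

/-- `(∑ₖ hₖ(X−Y) tᵏ) · ∏ᵢ (1 - xᵢ t) = ∏ⱼ (1 - yⱼ t)`. -/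
theorem mk_hXYZ_mul_map_esymmSeries (a b : ℕ) :
    PowerSeries.mk (fun k : ℕ => hXYZ a b k) *
        PowerSeries.map (rename (R := ℂ) Sum.inl).toRingHom (esymmSeries (Fin a) ℂ) =
      PowerSeries.map (rename (R := ℂ) Sum.inr).toRingHom (esymmSeries (Fin b) ℂ) := by
  have h : PowerSeries.mk (fun k : ℕ => hXYZ a b k) =
      PowerSeries.map (rename (R := ℂ) Sum.inr).toRingHom (esymmSeries (Fin b) ℂ) *
        PowerSeries.map (rename (R := ℂ) Sum.inl).toRingHom
          (PowerSeries.mk (hsymm (Fin a) ℂ)) := by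
    ext1 k
    rw [PowerSeries.coeff_mul, Finset.Nat.sum_antidiagonal_eq_sum_range_succ_mk]
    simp only [hXYZ, PowerSeries.coeff_mk, PowerSeries.coeff_map, esymmSeries]
    rw [if_pos (Int.natCast_nonneg k)]
    refine Finset.sum_congr rfl fun j _ => ?_
    simp [MvPolynomial.smul_eq_C_mul, mul_assoc]
  rw [h, mul_assoc, ← map_mul, mk_hsymm_mul_esymmSeries, map_one, mul_one]

theorem esymm_eq_zero_of_card_lt (σ R : Type*) [Fintype σ] [CommRing R] {k : ℕ}
    (hk : Fintype.card σ < k) : esymm σ R k = 0 := by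
  rw [esymm, Finset.powersetCard_eq_empty.2 (by simpa using hk), Finset.sum_empty]

/-- The linear recurrence with coefficients `(-1)ʳ eᵣ(X)` satisfied by `hₖ(X−Y)` for `k > b`. -/
theorem sum_hXYZ_mul_esymm_eq_zero {a b m k : ℕ} (ham : a < m) (hbk : b < k) :
    ∑ r ∈ Finset.range m,
      hXYZ a b ((k : ℤ) - r) * rename Sum.inl ((-1) ^ r * esymm (Fin a) ℂ r) = 0 := by
  have h := congrArg (PowerSeries.coeff k) (mk_hXYZ_mul_map_esymmSeries a b)
  rw [mul_comm, PowerSeries.coeff_mul, Finset.Nat.sum_antidiagonal_eq_sum_range_succ_mk] at h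
  simp only [PowerSeries.coeff_mk, PowerSeries.coeff_map, esymmSeries] at h
  rw [esymm_eq_zero_of_card_lt (Fin b) ℂ (by simpa using hbk), mul_zero, map_zero] at h
  have hvanish (r : ℕ) (hr : a < r ∨ k < r) :
      hXYZ a b ((k : ℤ) - r) * rename Sum.inl ((-1) ^ r * esymm (Fin a) ℂ r) = 0 := by
    rcases hr with hr | hr
    · rw [esymm_eq_zero_of_card_lt (Fin a) ℂ (by simpa using hr), mul_zero, map_zero, mul_zero]
    · rw [hXYZ, if_neg (by omega), zero_mul]
  rw [← Finset.eventually_constant_sum (fun r hr => hvanish r (Or.inl (by omega)))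
      (show m ≤ m + (k + 1) by omega),
    Finset.eventually_constant_sum (fun r hr => hvanish r (Or.inr (by omega)))
      (show k + 1 ≤ m + (k + 1) by omega), ← h]
  refine Finset.sum_congr rfl fun r hr => ?_
  rw [Nat.cast_sub (by simpa [Nat.lt_succ_iff] using hr), mul_comm]
  rfl

/-- If `m > a` and `n > b`, then `det( h_{n−i+j}(X−Y) )_{1≤i,j≤m} = 0`
in `ℂ[x₁,…,x_a,y₁,…,y_b]`. -/
theorem schur_det_vanish (a b m n : ℕ) (ham : a < m) (hbn : b < n) :
    (Matrix.of fun i j : Fin m =>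
        hXYZ a b ((n : ℤ) - ((i : ℕ) : ℤ) + ((j : ℕ) : ℤ))).det = 0 := by
  rw [← Matrix.exists_mulVec_eq_zero_iff]
  refine ⟨fun j => rename Sum.inl ((-1) ^ (m - 1 - j : ℕ) * esymm (Fin a) ℂ (m - 1 - j)), ?_, ?_⟩
  · intro h
    simpa using congrFun h ⟨m - 1, by omega⟩
  · ext1 i
    have hi := i.isLt
    simp only [Matrix.mulVec, dotProduct, Matrix.of_apply, Pi.zero_apply]
    rw [← sum_hXYZ_mul_esymm_eq_zero ham (show b < n + (m - 1 - i) by omega),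
      Finset.sum_range, ← Equiv.sum_comp Fin.revPerm]
    refine Finset.sum_congr rfl fun j _ => ?_
    have hj := j.isLt
    rw [Fin.revPerm_apply, Fin.val_rev, show m - 1 - (m - (j + 1)) = (j : ℕ) by omega]
    congr 2
    omega
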